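/- arXiv:1806.09361 — 2 statements merged into one kernel-verified Lean document; each statement's English description precedes it below -/
import Mathlib

section
/- Every complex Hilbert space H has the Bishop-Phelps-Bollobás point property for normal operators: for every ε > 0 there exists η > 0 such that whenever T is a bounded linear operator on H with T ∘ T* = T* ∘ T, ‖T‖ = 1, and x₀ ∈ H is a unit vector satisfying ‖T x₀‖ > 1 − η, there exists a bounded linear operator S on H with S ∘ S* = S* ∘ S, ‖S‖ = 1, ‖S x₀‖ = 1, and ‖S − T‖ < ε. -/
open ContinuousLinearMap
open scoped ComplexOrder

section Rotation

variable {H : Type*} [NormedAddCommGroup H] [InnerProductSpace ℂ H]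

lemma norm_reflection_sub_reflection_le {u w : H} (hu : ‖u‖ = 1) (hw : ‖w‖ = 1) (z : H) :
    ‖(ℂ ∙ w).reflection z - (ℂ ∙ u).reflection z‖ ≤ 4 * ‖w - u‖ * ‖z‖ := by
  rw [Submodule.reflection_apply, Submodule.reflection_apply,
    Submodule.starProjection_unit_singleton ℂ hw, Submodule.starProjection_unit_singleton ℂ hu]
  have key : (2 • (inner ℂ w z • w) - z) - (2 • (inner ℂ u z • u) - z)
      = (2 : ℂ) • (inner ℂ (w - u) z • w + inner ℂ u z • (w - u)) := by
    rw [inner_sub_left]; module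
  rw [key, norm_smul, Complex.norm_ofNat]
  have h1 : ‖inner ℂ (w - u) z • w‖ ≤ ‖w - u‖ * ‖z‖ := by
    rw [norm_smul, hw, mul_one]; exact norm_inner_le_norm _ _
  have h2 : ‖inner ℂ u z • (w - u)‖ ≤ ‖w - u‖ * ‖z‖ := by
    rw [norm_smul, mul_comm]
    gcongr
    simpa [hu] using norm_inner_le_norm (𝕜 := ℂ) u z
  have h3 := norm_add_le (inner ℂ (w - u) z • w) (inner ℂ u z • (w - u))
  linarith

/-- A unit vector can be moved to a nearby unit vector by a unitary close to the identity. -/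
lemma exists_linearIsometryEquiv_apply_eq {u x : H} (hu : ‖u‖ = 1) (hx : ‖x‖ = 1)
    (hux : inner ℂ u x = inner ℂ x u) (hd : ‖x - u‖ ≤ 1) :
    ∃ U : H ≃ₗᵢ[ℂ] H, U u = x ∧ ∀ y, ‖U y - y‖ ≤ 4 * ‖x - u‖ * ‖y‖ := by
  set m := ‖u + x‖ with hm
  have hm1 : 2 - m ≤ ‖x - u‖ := by
    have h := norm_sub_norm_le ((2 : ℂ) • u) (u + x)
    have e : (2 : ℂ) • u - (u + x) = -(x - u) := by module
    rw [e, norm_neg, norm_smul, hu] at h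
    norm_num at h
    linarith
  have hm2 : m ≤ 2 := by linarith [norm_add_le u x]
  have hm0 : 0 < m := by linarith
  set w : H := ((m⁻¹ : ℝ) : ℂ) • (u + x) with hwdef
  have hw : ‖w‖ = 1 := by
    rw [hwdef, norm_smul, Complex.norm_real, ← hm, norm_inv, Real.norm_of_nonneg hm0.le]
    field_simp
  have hwm : (m : ℂ) • w = u + x := by
    rw [hwdef, smul_smul, ← Complex.ofReal_mul, mul_inv_cancel₀ hm0.ne']; simp
  have hwu : ‖w - u‖ ≤ ‖x - u‖ := by
    have e : (2 : ℂ) • (w - u) = (x - u) + ((2 - m : ℝ) : ℂ) • w := by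
      have : x = (m : ℂ) • w - u := by rw [hwm]; abel
      rw [this]; push_cast; module
    have h := norm_add_le (x - u) (((2 - m : ℝ) : ℂ) • w)
    rw [← e, norm_smul, norm_smul, hw, Complex.norm_real, Real.norm_of_nonneg (by linarith)] at h
    norm_num at h
    linarith
  have hplus : (ℂ ∙ w).reflection (u + x) = u + x := by
    rw [Submodule.reflection_eq_self_iff, ← hwm]
    exact Submodule.smul_mem _ _ (Submodule.mem_span_singleton_self w)
  have hminus : (ℂ ∙ w).reflection (u - x) = -(u - x) := by
    apply Submodule.reflection_mem_subspace_orthogonalComplement_eq_neg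
    rw [Submodule.mem_orthogonal_singleton_iff_inner_right, hwdef, inner_smul_left]
    have : inner ℂ (u + x) (u - x) = 0 := by
      rw [inner_add_left, inner_sub_right, inner_sub_right, inner_self_eq_norm_sq_to_K,
        inner_self_eq_norm_sq_to_K, hu, hx, hux]
      ring
    rw [this, mul_zero]
  have hRu : (ℂ ∙ u).reflection u = u :=
    (Submodule.reflection_eq_self_iff _).2 (Submodule.mem_span_singleton_self u)
  refine ⟨(ℂ ∙ u).reflection.trans (ℂ ∙ w).reflection, ?_, fun y ↦ ?_⟩
  · have e : u = (2⁻¹ : ℂ) • ((u + x) + (u - x)) := by module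
    rw [LinearIsometryEquiv.trans_apply, hRu]
    nth_rewrite 1 [e]
    rw [map_smul, map_add, hplus, hminus]
    module
  · rw [LinearIsometryEquiv.trans_apply]
    have h := norm_reflection_sub_reflection_le hu hw ((ℂ ∙ u).reflection y)
    rw [Submodule.reflection_reflection, LinearIsometryEquiv.norm_map] at h
    exact h.trans (by gcongr)

end Rotation

section Truncation

variable {H : Type*} [NormedAddCommGroup H] [InnerProductSpace ℂ H] [CompleteSpace H]

/-- The radial function `z / max |z| r` of a normal contraction is a normal contraction close to it
and isometric on a vector close to any vector which is almost normed by the contraction. -/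
lemma exists_normal_isometric_near {T : H →L[ℂ] H} (hT : IsStarNormal T) (hT1 : ‖T‖ ≤ 1)
    {r : ℝ} (hr0 : 0 < r) (hr1 : r < 1) :
    ∃ N K : H →L[ℂ] H, IsStarNormal N ∧ ‖N‖ ≤ 1 ∧ ‖N - T‖ ≤ 1 - r ∧ 0 ≤ K ∧
      (∀ x, ‖N (K x)‖ = ‖K x‖) ∧
      ∀ x, (1 - r ^ 2) * ‖x - K x‖ ^ 2 ≤ ‖x‖ ^ 2 - ‖T x‖ ^ 2 := by
  have hr2 : 0 < 1 - r ^ 2 := by nlinarith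
  have hm (z : ℂ) : 0 < max ‖z‖ r := lt_max_of_lt_right hr0
  let f : ℂ → ℂ := fun z ↦ z / (max ‖z‖ r : ℝ)
  let k : ℂ → ℝ := fun z ↦ max (‖z‖ ^ 2 - r ^ 2) 0 / (1 - r ^ 2)
  let h : ℂ → ℂ := fun z ↦ (k z : ℂ)
  have hfc : Continuous f := by
    refine continuous_id.div (by fun_prop) fun z ↦ ?_
    exact_mod_cast (hm z).ne'
  have hkc : Continuous k := by fun_prop
  have hhc : Continuous h := by fun_prop
  have hspec {z : ℂ} (hz : z ∈ spectrum ℂ T) : ‖z‖ ≤ 1 := by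
    rcases subsingleton_or_nontrivial (H →L[ℂ] H) with hs | hs
    · simp [spectrum.of_subsingleton] at hz
    · exact (spectrum.norm_le_norm_of_mem hz).trans hT1
  have hf1 (z : ℂ) : ‖f z‖ ≤ 1 := by
    simp only [f, norm_div, Complex.norm_real, Real.norm_of_nonneg (hm z).le]
    exact (div_le_one (hm z)).2 (le_max_left _ _)
  have hk0 (z : ℂ) : 0 ≤ k z := div_nonneg (le_max_right _ _) hr2.le
  refine ⟨cfc f T, cfc h T, cfc_predicate f T, norm_cfc_le zero_le_one fun z _ ↦ hf1 z,
    ?_, ?_, ?_, ?_⟩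
  · have e : cfc f T - T = cfc (fun z ↦ f z - z) T := by
      rw [cfc_sub f (fun z ↦ z) T hfc.continuousOn continuousOn_id, cfc_id' ℂ T]
    rw [e]
    refine norm_cfc_le (by linarith) fun z hz ↦ ?_
    have hz1 := hspec hz
    have hmr : r ≤ max ‖z‖ r := le_max_right _ _
    have hm1 : max ‖z‖ r ≤ 1 := max_le hz1 hr1.le
    have e2 : f z - z = f z * ((1 - max ‖z‖ r : ℝ) : ℂ) := by
      have : ((max ‖z‖ r : ℝ) : ℂ) ≠ 0 := by exact_mod_cast (hm z).ne'
      simp only [f]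
      rw [Complex.ofReal_sub, Complex.ofReal_one]
      field_simp
    rw [e2, norm_mul, Complex.norm_real, Real.norm_of_nonneg (by linarith)]
    have := mul_le_mul_of_nonneg_right (hf1 z) (show 0 ≤ 1 - max ‖z‖ r by linarith)
    linarith
  · refine cfc_nonneg fun z _ ↦ ?_
    simpa [h] using hk0 z
  · have e : star (cfc f T) * cfc f T * cfc h T = cfc h T := by
      rw [← cfc_star, ← cfc_mul _ _ T (by fun_prop) (by fun_prop),
        ← cfc_mul _ _ T (by fun_prop) (by fun_prop)]
      congr 1
      ext1 z
      rcases le_or_gt ‖z‖ r with hz | hz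
      · have : k z = 0 := by
          have : ‖z‖ ^ 2 - r ^ 2 ≤ 0 := by nlinarith [norm_nonneg z]
          simp [k, max_eq_right this]
        simp [h, this]
      · have : ‖f z‖ = 1 := by
          simp only [f, norm_div, Complex.norm_real, max_eq_left hz.le, norm_norm]
          exact div_self (hr0.trans hz).ne'
        have : star (f z) * f z = 1 := by
          rw [Complex.star_def, Complex.conj_mul', this]; simp
        rw [this, one_mul]
    intro x
    have e' : (star (cfc f T) * cfc f T) (cfc h T x) = cfc h T x := DFunLike.congr_fun e x
    rw [← sq_eq_sq₀ (norm_nonneg _) (norm_nonneg _), apply_norm_sq_eq_inner_adjoint_left,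
      ← star_eq_adjoint, ← mul_def, e', inner_self_eq_norm_sq]
  · intro x
    let g : ℂ → ℂ := fun z ↦ 1 - star z * z - ((1 - r ^ 2 : ℝ) : ℂ) * (star (1 - h z) * (1 - h z))
    have hg : 0 ≤ cfc g T := by
      refine cfc_nonneg fun z hz ↦ ?_
      have hz1 := hspec hz
      have hz2 : ‖z‖ ^ 2 ≤ 1 := by nlinarith [norm_nonneg z]
      have e : g z = ((1 - ‖z‖ ^ 2 - (1 - r ^ 2) * (1 - k z) ^ 2 : ℝ) : ℂ) := by
        simp only [g, h, Complex.star_def, Complex.conj_mul', map_sub, map_one,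
          Complex.conj_ofReal]
        push_cast
        ring
      rw [e, Complex.zero_le_real]
      have hk : (1 - r ^ 2) * k z = max (‖z‖ ^ 2 - r ^ 2) 0 := mul_div_cancel₀ _ hr2.ne'
      have hk1 : k z ≤ 1 := by
        refine (div_le_one hr2).2 (max_le (by linarith) hr2.le)
      have hk2 : ‖z‖ ^ 2 - r ^ 2 ≤ (1 - r ^ 2) * k z := hk ▸ le_max_left _ _
      have : (1 - r ^ 2) * (1 - k z) ^ 2 ≤ (1 - r ^ 2) * (1 - k z) := by
        gcongr
        nlinarith [hk0 z]
      linarith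
    have e : cfc g T = 1 - star T * T
        - ((1 - r ^ 2 : ℝ) : ℂ) • (star (1 - cfc h T) * (1 - cfc h T)) := by
      have e1 : cfc (fun z ↦ 1 - h z) T = 1 - cfc h T := by
        rw [cfc_sub (fun _ ↦ (1 : ℂ)) h T (by fun_prop) (by fun_prop), cfc_const_one ℂ T]
      have e2 : cfc (fun z : ℂ ↦ star z * z) T = star T * T := by
        rw [cfc_mul (fun z : ℂ ↦ star z) (fun z ↦ z) T (by fun_prop) (by fun_prop),
          cfc_star (fun z ↦ z) T, cfc_id' ℂ T]
      have e3 : cfc (fun z ↦ star (1 - h z) * (1 - h z)) T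
          = star (1 - cfc h T) * (1 - cfc h T) := by
        rw [cfc_mul _ _ T (by fun_prop) (by fun_prop), cfc_star (fun z ↦ 1 - h z) T, e1]
      simp only [g]
      rw [cfc_sub _ _ T (by fun_prop) (by fun_prop), cfc_sub _ _ T (by fun_prop) (by fun_prop),
        cfc_const_mul _ _ T (by fun_prop), e2, e3, cfc_const_one ℂ T]
    have hpos := ((nonneg_iff_isPositive _).1 hg).re_inner_nonneg_left x
    have e3 : x - cfc h T x = (1 - cfc h T) x := rfl
    have e4 : cfc g T x = x - (adjoint T ∘L T) x - ((1 - r ^ 2 : ℝ) : ℂ) •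
        (adjoint (1 - cfc h T) ∘L (1 - cfc h T)) x := DFunLike.congr_fun e x
    rw [e4, inner_sub_left, inner_sub_left, inner_smul_left, Complex.conj_ofReal, map_sub, map_sub,
      RCLike.re_to_complex, RCLike.re_to_complex, RCLike.re_to_complex, Complex.re_ofReal_mul] at hpos
    rw [e3, apply_norm_sq_eq_inner_adjoint_left T, apply_norm_sq_eq_inner_adjoint_left,
      ← inner_self_eq_norm_sq (𝕜 := ℂ) x]
    simp only [RCLike.re_to_complex]
    linarith

end Truncation

theorem stmt9 {H : Type*} [NormedAddCommGroup H] [InnerProductSpace ℂ H] [CompleteSpace H] :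
    ∀ ε > (0 : ℝ), ∃ η > (0 : ℝ), ∀ T : H →L[ℂ] H, (T ∘L adjoint T = adjoint T ∘L T) → ‖T‖ = 1 →
      ∀ x₀ : H, ‖x₀‖ = 1 → ‖T x₀‖ > 1 - η →
      ∃ S : H →L[ℂ] H, (S ∘L adjoint S = adjoint S ∘L S) ∧ ‖S‖ = 1 ∧ ‖S x₀‖ = 1 ∧ ‖S - T‖ < ε := by
  intro ε hε
  obtain ⟨δ, hδ0, hδ1, hδε⟩ : ∃ δ : ℝ, 0 < δ ∧ δ ≤ 1 / 2 ∧ δ ≤ ε / 2 :=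
    ⟨min (1 / 2) (ε / 2), by positivity, min_le_left _ _, min_le_right _ _⟩
  refine ⟨δ ^ 3 / 2048, by positivity, fun T hT hT1 x₀ hx₀ hTx ↦ ?_⟩
  obtain ⟨N, K, hN, hN1, hNT, hK, hNK, hKx⟩ := exists_normal_isometric_near
    (T := T) ⟨hT.symm⟩ hT1.le (r := 1 - δ) (by linarith) (by linarith)
  have hd : ‖x₀ - K x₀‖ ≤ δ / 32 := by
    refine abs_le_of_sq_le_sq' ?_ (by positivity) |>.2
    have h := hKx x₀
    rw [hx₀] at h
    have h1 : δ * ‖x₀ - K x₀‖ ^ 2 ≤ (1 - (1 - δ) ^ 2) * ‖x₀ - K x₀‖ ^ 2 := by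
      gcongr; nlinarith
    have h2 : (1 : ℝ) ^ 2 - ‖T x₀‖ ^ 2 ≤ 2 * (δ ^ 3 / 2048) := by
      have : 0 < δ ^ 3 / 2048 := by positivity
      nlinarith [sq_nonneg (1 - ‖T x₀‖)]
    refine le_of_mul_le_mul_left ?_ hδ0
    nlinarith
  set c := ‖K x₀‖ with hc
  have hc1 : |1 - c| ≤ ‖x₀ - K x₀‖ := by
    rw [← hx₀]; exact abs_norm_sub_norm_le _ _
  obtain ⟨hc2, hc3⟩ := abs_le.1 hc1
  have hc0 : 0 < c := by linarith
  set u : H := ((c⁻¹ : ℝ) : ℂ) • K x₀ with hudef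
  have hu : ‖u‖ = 1 := by
    rw [hudef, norm_smul, Complex.norm_real, norm_inv, Real.norm_of_nonneg hc0.le, ← hc]
    field_simp
  have hcu : (c : ℂ) • u = K x₀ := by
    rw [hudef, smul_smul, ← Complex.ofReal_mul, mul_inv_cancel₀ hc0.ne']; simp
  have hNu : ‖N u‖ = 1 := by
    rw [← hu, hudef, map_smul, norm_smul, norm_smul, hNK]
  have hxu : ‖x₀ - u‖ ≤ 2 * ‖x₀ - K x₀‖ := by
    have e : x₀ - u = (x₀ - K x₀) + ((c - 1 : ℝ) : ℂ) • u := by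
      rw [← hcu]; push_cast; module
    rw [e]
    refine (norm_add_le _ _).trans ?_
    rw [norm_smul, hu, Complex.norm_real, Real.norm_eq_abs, abs_sub_comm]
    linarith
  have hsymm : inner ℂ u x₀ = inner ℂ x₀ u := by
    have hKs := ((nonneg_iff_isPositive K).1 hK).isSelfAdjoint.isSymmetric x₀ x₀
    simp only [coe_coe] at hKs
    rw [hudef, inner_smul_left, inner_smul_right, hKs, Complex.conj_ofReal]
  obtain ⟨U, hUu, hU⟩ := exists_linearIsometryEquiv_apply_eq hu hx₀ hsymm (by linarith)
  have hS : IsStarNormal (U.conjStarAlgEquiv N) := hN.map U.conjStarAlgEquiv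
  have hSx : ‖U.conjStarAlgEquiv N x₀‖ = 1 := by
    rw [LinearIsometryEquiv.conjStarAlgEquiv_apply_apply, U.norm_map, ← hUu, U.symm_apply_apply,
      hNu]
  have hN1' (z : H) : ‖N z‖ ≤ ‖z‖ := by simpa using N.le_of_opNorm_le hN1 z
  have hSN : ‖U.conjStarAlgEquiv N - N‖ ≤ 8 * ‖x₀ - u‖ := by
    refine opNorm_le_bound _ (by positivity) fun y ↦ ?_
    obtain ⟨z, rfl⟩ := U.surjective y
    rw [sub_apply, LinearIsometryEquiv.conjStarAlgEquiv_apply_apply, U.symm_apply_apply, U.norm_map]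
    have e : U (N z) - N (U z) = (U (N z) - N z) - N (U z - z) := by
      rw [map_sub]; abel
    have h1 := (hU (N z)).trans (mul_le_mul_of_nonneg_left (hN1' z) (by positivity))
    have h2 := (hN1' (U z - z)).trans (hU z)
    rw [e]
    linarith [norm_sub_le (U (N z) - N z) (N (U z - z))]
  refine ⟨U.conjStarAlgEquiv N, hS.star_comm_self.eq.symm, le_antisymm ?_ ?_, hSx, ?_⟩
  · refine opNorm_le_bound _ zero_le_one fun y ↦ ?_
    rw [LinearIsometryEquiv.conjStarAlgEquiv_apply_apply, U.norm_map, one_mul]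
    exact (hN1' _).trans_eq (U.symm.norm_map y)
  · rw [← hSx]
    exact unit_le_opNorm _ _ hx₀.le
  · linarith [norm_sub_le_norm_sub_add_norm_sub (U.conjStarAlgEquiv N) N T]
end

section
/- Every complex Hilbert space H has the Bishop-Phelps-Bollobás point property for compact normal operators: for every ε > 0 there exists η > 0 such that whenever T is a compact bounded linear operator on H with T ∘ T* = T* ∘ T, ‖T‖ = 1, and x₀ ∈ H is a unit vector satisfying ‖T x₀‖ > 1 − η, there exists a compact bounded linear operator S on H with S ∘ S* = S* ∘ S, ‖S‖ = 1, ‖S x₀‖ = 1, and ‖S − T‖ < ε. -/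
open ContinuousLinearMap

section NormalCutoff

variable {A : Type*} [CStarAlgebra A]

/-- Continuous functional calculus at a normal contraction `a`: `a * g` pushes the part of the
spectrum outside the disc of radius `r` to the unit circle, and `p` is a continuous cut-off to that
part. -/
theorem exists_normal_cutoff [Nontrivial A] (a : A) [IsStarNormal a] (ha : ‖a‖ ≤ 1) {r : ℝ}
    (hr₀ : 0 < r) (hr₁ : r < 1) :
    ∃ g p k : A, IsStarNormal (a * g) ∧ ‖a * g‖ ≤ 1 ∧ ‖a * g - a‖ ≤ 1 - r ∧ star p = p ∧
      star (a * g) * (a * g) * p = p ∧ 1 - p = k * (1 - star a * a) ∧ ‖k‖ ≤ (1 - r ^ 2)⁻¹ := by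
  have hc : 0 < 1 - r ^ 2 := by nlinarith
  obtain ⟨g, hg_def⟩ : ∃ g : ℂ → ℂ, ∀ z, g z = ((max ‖z‖ r)⁻¹ : ℝ) := ⟨_, fun _ ↦ rfl⟩
  obtain ⟨k, hk_def⟩ : ∃ k : ℂ → ℂ, ∀ z, k z = ((max (1 - ‖z‖ ^ 2) (1 - r ^ 2))⁻¹ : ℝ) :=
    ⟨_, fun _ ↦ rfl⟩
  obtain ⟨p, hp_def⟩ : ∃ p : ℂ → ℂ, ∀ z, p z = 1 - k z * (1 - star z * z) := ⟨_, fun _ ↦ rfl⟩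
  have hg : Continuous g := by
    rw [funext hg_def]
    exact Complex.continuous_ofReal.comp <|
    (continuous_norm.max continuous_const).inv₀ fun z ↦ (hr₀.trans_le (le_max_right _ _)).ne'
  have hk : Continuous k := by
    rw [funext hk_def]
    exact Complex.continuous_ofReal.comp <|
    ((continuous_const.sub (continuous_norm.pow 2)).max continuous_const).inv₀
      fun z ↦ (hc.trans_le (le_max_right _ _)).ne'
  have hp : Continuous p := by
    rw [funext hp_def]
    fun_prop
  have hag : cfc (fun z ↦ z * g z) a = a * cfc g a := by
    rw [cfc_mul (fun z ↦ z) g a, cfc_id' ℂ a]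
  have hspec : ∀ z ∈ spectrum ℂ a, ‖z‖ ≤ 1 := fun z hz ↦
    (spectrum.norm_le_norm_of_mem hz).trans ha
  have hstar : ∀ z : ℂ, star z * z = ((‖z‖ ^ 2 : ℝ) : ℂ) := fun z ↦ by
    simpa using Complex.conj_mul' z
  refine ⟨cfc g a, cfc p a, cfc k a, ?_, ?_, ?_, ?_, ?_, ?_, ?_⟩
  · rw [← hag]
    exact cfc_predicate _ a
  · rw [← hag]
    refine norm_cfc_le zero_le_one fun z _ ↦ ?_
    have hm : 0 < max ‖z‖ r := hr₀.trans_le (le_max_right _ _)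
    simp only [hg_def, norm_mul, Complex.norm_real, Real.norm_eq_abs, abs_of_pos (inv_pos.2 hm)]
    rw [← div_eq_mul_inv, div_le_one hm]
    exact le_max_left _ _
  · have : a * cfc g a - a = cfc (fun z ↦ z * g z - z) a := by
      rw [cfc_sub (fun z ↦ z * g z) (fun z ↦ z) a, hag, cfc_id' ℂ a]
    rw [this]
    refine norm_cfc_le (by linarith) fun z hz ↦ ?_
    have hz := hspec z hz
    have hm : 0 < max ‖z‖ r := hr₀.trans_le (le_max_right _ _)
    have hm₁ : max ‖z‖ r ≤ 1 := max_le hz hr₁.le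
    have hzm : ‖z‖ * (max ‖z‖ r)⁻¹ ≤ 1 := by
      rw [← div_eq_mul_inv, div_le_one hm]
      exact le_max_left _ _
    have h : z * g z - z = z * (((max ‖z‖ r)⁻¹ * (1 - max ‖z‖ r) : ℝ) : ℂ) := by
      have : (max ‖z‖ r)⁻¹ * (1 - max ‖z‖ r) = (max ‖z‖ r)⁻¹ - 1 := by
        field_simp
      rw [this]
      simp only [hg_def]
      push_cast
      ring
    rw [h, norm_mul, Complex.norm_real, Real.norm_eq_abs, abs_of_nonneg
      (mul_nonneg (inv_pos.2 hm).le (by linarith)), ← mul_assoc]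
    nlinarith [le_max_right ‖z‖ r]
  · rw [← cfc_star]
    refine cfc_congr fun z _ ↦ ?_
    simp only [hp_def, hstar, hk_def]
    simp
  · rw [← hag, ← cfc_star, ← cfc_mul _ _ a, ← cfc_mul _ _ a]
    refine cfc_congr fun z _ ↦ ?_
    simp only [hstar, hp_def, hg_def, hk_def]
    norm_cast
    rw [norm_mul, Complex.norm_real, Real.norm_eq_abs]
    rcases le_total ‖z‖ r with h | h
    · have h₁ : 1 - r ^ 2 ≤ 1 - ‖z‖ ^ 2 := by nlinarith [norm_nonneg z]
      rw [max_eq_left h₁, inv_mul_cancel₀ (by linarith)]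
      simp
    · have hz : 0 < ‖z‖ := hr₀.trans_le h
      rw [max_eq_left h, abs_of_pos (inv_pos.2 hz), mul_inv_cancel₀ hz.ne']
      simp
  · have h : (1 : A) - cfc p a = cfc (fun z ↦ 1 - p z) a := by
      rw [cfc_sub (fun _ ↦ 1) p a, cfc_const_one ℂ a]
    have h' : (1 : A) - star a * a = cfc (fun z : ℂ ↦ 1 - star z * z) a := by
      rw [cfc_sub (fun _ ↦ 1) (fun z : ℂ ↦ star z * z) a, cfc_const_one ℂ a,
        cfc_mul (fun z : ℂ ↦ star z) (fun z ↦ z) a, cfc_star (fun z : ℂ ↦ z) a,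
        cfc_id' ℂ a]
    rw [h, h', ← cfc_mul _ _ a]
    refine cfc_congr fun z _ ↦ ?_
    simp [hp_def]
  · refine norm_cfc_le (inv_pos.2 hc).le fun z _ ↦ ?_
    have hm : 0 < max (1 - ‖z‖ ^ 2) (1 - r ^ 2) := hc.trans_le (le_max_right _ _)
    simp only [hk_def, Complex.norm_real, Real.norm_eq_abs, abs_of_pos (inv_pos.2 hm)]
    exact inv_anti₀ hc (le_max_right _ _)

end NormalCutoff

section Rotation

variable {H : Type*} [NormedAddCommGroup H] [InnerProductSpace ℂ H]

theorem norm_normalize_sub_le {a u : H} (ha : ‖a‖ = 1) :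
    ‖((‖u‖⁻¹ : ℝ) : ℂ) • u - a‖ ≤ 2 * ‖u - a‖ := by
  rcases eq_or_ne u 0 with rfl | hu
  · simp [ha]
  have hu' : 0 < ‖u‖ := norm_pos_iff.2 hu
  have h₁ : ‖((‖u‖⁻¹ : ℝ) : ℂ) • u - u‖ = |1 - ‖u‖| := by
    have : ((‖u‖⁻¹ : ℝ) : ℂ) • u - u = ((‖u‖⁻¹ - 1 : ℝ) : ℂ) • u := by
      push_cast
      rw [sub_smul, one_smul]
    rw [this, norm_smul, Complex.norm_real, Real.norm_eq_abs, ← abs_of_pos hu', ← abs_mul,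
      abs_of_pos hu', sub_mul, inv_mul_cancel₀ hu'.ne', one_mul]
  have h₂ : |1 - ‖u‖| ≤ ‖u - a‖ := by
    rw [← ha, norm_sub_rev]
    exact abs_norm_sub_norm_le a u
  linarith [norm_sub_le_norm_sub_add_norm_sub (((‖u‖⁻¹ : ℝ) : ℂ) • u) u a]

theorem norm_reflection_singleton_sub_le {m a : H} (hm : ‖m‖ = 1) (ha : ‖a‖ = 1) (x : H) :
    ‖(ℂ ∙ m).reflection x - (ℂ ∙ a).reflection x‖ ≤ 4 * ‖m - a‖ * ‖x‖ := by
  have h : (ℂ ∙ m).reflection x - (ℂ ∙ a).reflection x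
      = (2 : ℂ) • (inner ℂ (m - a) x • m + inner ℂ a x • (m - a)) := by
    rw [Submodule.reflection_singleton_apply, Submodule.reflection_singleton_apply, hm, ha,
      inner_sub_left]
    simp only [RCLike.ofReal_one, one_pow, div_one]
    module
  have h₁ : ‖inner ℂ (m - a) x • m‖ ≤ ‖m - a‖ * ‖x‖ := by
    rw [norm_smul, hm, mul_one]
    exact norm_inner_le_norm _ _
  have h₂ : ‖inner ℂ a x • (m - a)‖ ≤ ‖m - a‖ * ‖x‖ := by
    rw [norm_smul, mul_comm]
    gcongr
    simpa [ha] using norm_inner_le_norm (𝕜 := ℂ) a x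
  rw [h, norm_smul, Complex.norm_ofNat]
  linarith [norm_add_le (inner ℂ (m - a) x • m) (inner ℂ a x • (m - a))]

variable [CompleteSpace H]

/-- A product of two reflections rotating `a` to `b`. -/
theorem exists_unitary_apply_eq {a b : H} (ha : ‖a‖ = 1) (hb : ‖b‖ = 1)
    (hab : inner ℂ a b = inner ℂ b a) (hne : a + b ≠ 0) :
    ∃ U : unitary (H →L[ℂ] H), (U : H →L[ℂ] H) a = b ∧ ‖(U : H →L[ℂ] H) - 1‖ ≤ 4 * ‖b - a‖ := by
  set s := a + b with hs
  have hs' : 0 < ‖s‖ := norm_pos_iff.2 hne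
  set m : H := ((‖s‖⁻¹ : ℝ) : ℂ) • s with hm
  have hm₁ : ‖m‖ = 1 := by
    rw [hm, norm_smul, Complex.norm_real, norm_inv, norm_norm, inv_mul_cancel₀ hs'.ne']
  have hma : ‖m - a‖ ≤ ‖b - a‖ := by
    have hm₂ : m = ((‖(2⁻¹ : ℂ) • s‖⁻¹ : ℝ) : ℂ) • ((2⁻¹ : ℂ) • s) := by
      rw [hm, norm_smul, smul_smul]
      congr 1
      simp
    rw [hm₂]
    refine (norm_normalize_sub_le ha).trans_eq ?_
    have : (2⁻¹ : ℂ) • s - a = (2⁻¹ : ℂ) • (b - a) := by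
      rw [hs]
      module
    rw [this, norm_smul]
    simp
  have hRa : (ℂ ∙ a).reflection a = a :=
    Submodule.reflection_mem_subspace_eq_self (Submodule.mem_span_singleton_self a)
  have hRm : (ℂ ∙ m).reflection a = b := by
    have hspan : (ℂ ∙ m) = (ℂ ∙ s) :=
      Submodule.span_singleton_smul_eq (by simpa using hne) s
    have hR : (ℂ ∙ m).reflection a = (ℂ ∙ s).reflection a := by simp only [hspan]
    rw [hR, Submodule.reflection_singleton_apply]
    have h₁ : ((‖s‖ : ℂ)) ^ 2 = 2 * inner ℂ s a := by
      refine (inner_self_eq_norm_sq_to_K (𝕜 := ℂ) s).symm.trans ?_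
      simp only [hs, inner_add_left, inner_add_right, hab]
      simp only [inner_self_eq_norm_sq_to_K, ha, hb]
      simp
      ring
    have h₂ : (2 : ℂ) * (inner ℂ s a / (‖s‖ : ℂ) ^ 2) = 1 := by
      have h₃ : ((‖s‖ : ℂ)) ^ 2 ≠ 0 := by simpa using hne
      rw [← mul_div_assoc, ← h₁, div_self h₃]
    have h₄ : (2 • (inner ℂ s a / (‖s‖ : ℂ) ^ 2) • s) = s := by
      rw [← Nat.cast_smul_eq_nsmul ℂ, smul_smul]
      push_cast
      rw [h₂, one_smul]
    exact (congrArg (· - a) h₄).trans (by rw [hs]; abel)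
  refine ⟨Unitary.linearIsometryEquiv.symm ((ℂ ∙ a).reflection.trans (ℂ ∙ m).reflection), ?_, ?_⟩
  · simp [hRa, hRm]
  · refine ContinuousLinearMap.opNorm_le_bound _ (by positivity) fun x ↦ ?_
    have h := norm_reflection_singleton_sub_le hm₁ ha ((ℂ ∙ a).reflection x)
    rw [Submodule.reflection_reflection, LinearIsometryEquiv.norm_map] at h
    refine le_trans ?_ (h.trans (by gcongr))
    simp

end Rotation

theorem norm_unitary_conj_sub_le {A : Type*} [CStarAlgebra A] (u : unitary A) {t : A}
    (ht : ‖t‖ ≤ 1) : ‖star (u : A) * t * u - t‖ ≤ 2 * ‖(u : A) - 1‖ := by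
  have h : (u : A) * (star (u : A) * t * u - t) = t * (u - 1) - (u - 1) * t := by
    rw [mul_sub, ← mul_assoc, ← mul_assoc, Unitary.mul_star_self_of_mem u.2]
    noncomm_ring
  rw [← CStarRing.norm_coe_unitary_mul u, h]
  have h₁ : ‖t * ((u : A) - 1)‖ ≤ ‖(u : A) - 1‖ :=
    (norm_mul_le _ _).trans (mul_le_of_le_one_left (norm_nonneg _) ht)
  have h₂ : ‖((u : A) - 1) * t‖ ≤ ‖(u : A) - 1‖ :=
    (norm_mul_le _ _).trans (mul_le_of_le_one_right (norm_nonneg _) ht)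
  linarith [norm_sub_le (t * ((u : A) - 1)) (((u : A) - 1) * t)]

theorem norm_one_sub_adjoint_comp_self_apply_sq_le {H : Type*} [NormedAddCommGroup H]
    [InnerProductSpace ℂ H] [CompleteSpace H] {T : H →L[ℂ] H} (hT : ‖T‖ ≤ 1) {x : H}
    (hx : ‖x‖ = 1) : ‖x - adjoint T (T x)‖ ^ 2 ≤ 2 * (1 - ‖T x‖ ^ 2) := by
  have h₁ : ‖adjoint T (T x)‖ ≤ ‖T x‖ :=
    (le_opNorm _ _).trans (mul_le_of_le_one_left (norm_nonneg _) (by simpa using hT))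
  have h₂ : ‖T x‖ ≤ 1 := hx ▸ (le_opNorm _ _).trans (mul_le_of_le_one_left (norm_nonneg _) hT)
  have h₃ : RCLike.re (inner ℂ x (adjoint T (T x))) = ‖T x‖ ^ 2 := by
    rw [adjoint_inner_right, inner_self_eq_norm_sq]
  rw [@norm_sub_sq ℂ, h₃, hx]
  nlinarith [norm_nonneg (adjoint T (T x)), norm_nonneg (T x)]

theorem stmt10 {H : Type*} [NormedAddCommGroup H] [InnerProductSpace ℂ H] [CompleteSpace H] :
    ∀ ε > (0 : ℝ), ∃ η > (0 : ℝ), ∀ T : H →L[ℂ] H, (IsCompactOperator (⇑T) ∧ T ∘L adjoint T = adjoint T ∘L T) → ‖T‖ = 1 →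
      ∀ x₀ : H, ‖x₀‖ = 1 → ‖T x₀‖ > 1 - η →
      ∃ S : H →L[ℂ] H, (IsCompactOperator (⇑S) ∧ S ∘L adjoint S = adjoint S ∘L S) ∧ ‖S‖ = 1 ∧ ‖S x₀‖ = 1 ∧ ‖S - T‖ < ε := by
  intro ε hε
  set μ := min ε 1 with hμ
  have hμ₀ : 0 < μ := lt_min hε one_pos
  have hμ₁ : μ ≤ 1 := min_le_right _ _
  have hμε : μ ≤ ε := min_le_left _ _
  set r := 1 - μ / 4 with hr
  have hr₀ : 0 < r := by linarith
  have hr₁ : r < 1 := by linarith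
  have hc : 0 < 1 - r ^ 2 := by nlinarith
  refine ⟨((1 - r ^ 2) * (μ / 64)) ^ 2 / 4, by positivity, ?_⟩
  rintro T ⟨hTc, hTn⟩ hT x hx hTx
  have : Nontrivial H := ⟨x, 0, fun h ↦ by simp [h] at hx⟩
  have : IsStarNormal T := ⟨hTn.symm⟩
  obtain ⟨g, p, k, hN, hN₁, hNT, hp, hNp, hpk, hk⟩ := exists_normal_cutoff T hT.le hr₀ hr₁
  set N := T * g with hNdef
  have hu : ‖p x - x‖ ≤ μ / 64 := by
    have h₁ : x - p x = k (x - adjoint T (T x)) := DFunLike.congr_fun hpk x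
    have h₂ : ‖T x‖ ≤ 1 := by simpa [hT, hx] using T.le_opNorm x
    have h₃ : ‖x - adjoint T (T x)‖ ≤ (1 - r ^ 2) * (μ / 64) := by
      refine abs_le_of_sq_le_sq' ?_ (by positivity) |>.2
      have := norm_one_sub_adjoint_comp_self_apply_sq_le hT.le hx
      nlinarith [norm_nonneg (T x)]
    rw [norm_sub_rev, h₁]
    calc ‖k (x - adjoint T (T x))‖ ≤ (1 - r ^ 2)⁻¹ * ((1 - r ^ 2) * (μ / 64)) :=
          k.le_of_opNorm_le_of_le hk h₃
      _ = μ / 64 := by field_simp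
  set u := p x with hudef
  have hu₀ : u ≠ 0 := fun h ↦ by
    rw [h, zero_sub, norm_neg, hx] at hu
    linarith
  set w : H := ((‖u‖⁻¹ : ℝ) : ℂ) • u with hw
  have hw₁ : ‖w‖ = 1 := by
    rw [hw, norm_smul, Complex.norm_real, norm_inv, norm_norm, inv_mul_cancel₀ (by simpa)]
  have hwx : ‖w - x‖ ≤ μ / 32 := (norm_normalize_sub_le hx).trans (by linarith)
  have hxw : inner ℂ x w = inner ℂ w x := by
    have : inner ℂ x u = inner ℂ u x := by
      rw [hudef, ← adjoint_inner_left, ← star_eq_adjoint, hp]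
    rw [hw, inner_smul_left, inner_smul_right, this, Complex.conj_ofReal]
  have hne : x + w ≠ 0 := fun h ↦ by
    have h' : w - x = (-2 : ℂ) • x := by
      rw [eq_neg_of_add_eq_zero_right h]
      module
    rw [h', norm_smul, hx] at hwx
    norm_num at hwx
    linarith
  have hNw : ‖N w‖ = 1 := by
    have h : adjoint N (N w) = w := by
      rw [hw, map_smul, map_smul]
      exact congrArg _ (DFunLike.congr_fun hNp x)
    have h₁ := apply_norm_sq_eq_inner_adjoint_right N w
    change _ = RCLike.re (inner ℂ w (adjoint N (N w))) at h₁
    rw [h, inner_self_eq_norm_sq, hw₁, one_pow] at h₁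
    exact (pow_eq_one_iff_of_nonneg (norm_nonneg _) two_ne_zero).1 h₁
  obtain ⟨U, hU, hU₁⟩ := exists_unitary_apply_eq hx hw₁ hxw hne
  have hSN := norm_unitary_conj_sub_le U hN₁
  set S : H →L[ℂ] H := star (U : H →L[ℂ] H) * N * U with hS
  have hSx : ‖S x‖ = 1 := by
    have : S x = (star U : unitary (H →L[ℂ] H)).1 (N (U.1 x)) := rfl
    rw [this, Unitary.norm_map, hU, hNw]
  have hS₁ : ‖S‖ = 1 := by
    refine le_antisymm ?_ ?_
    · rw [hS, CStarRing.norm_mul_coe_unitary, ← Unitary.coe_star, CStarRing.norm_coe_unitary_mul]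
      exact hN₁
    · simpa [hSx, hx] using S.le_opNorm x
  refine ⟨S, ⟨?_, ?_⟩, hS₁, hSx, ?_⟩
  · exact ((hTc.comp_clm g).clm_comp (star (U : H →L[ℂ] H))).comp_clm (U : H →L[ℂ] H)
  · have hUU : (U : H →L[ℂ] H) * star (U : H →L[ℂ] H) = 1 := Unitary.mul_star_self_of_mem U.2
    change S * star S = star S * S
    calc S * star S
        = star (U : H →L[ℂ] H) * N * (U * star (U : H →L[ℂ] H)) * star N * U := by
          simp only [hS, star_mul, star_star, mul_assoc]
      _ = star (U : H →L[ℂ] H) * (star N * N) * U := by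
          rw [hUU, mul_one, mul_assoc _ N, hN.star_comm_self.eq]
      _ = star (U : H →L[ℂ] H) * star N * (U * star (U : H →L[ℂ] H)) * N * U := by
          rw [hUU, mul_one, mul_assoc _ (star N)]
      _ = star S * S := by
          simp only [hS, star_mul, star_star, mul_assoc]
  · linarith [norm_sub_le_norm_sub_add_norm_sub S N T]
end
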